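/- Let A be a ULH superpattern of C_{i_1,…,i_n} ∈ 𝒞. Then A is a companion matrix if and only if: (i) the constant part of A is a nilpotent matrix; (ii) A[1,…,i_1−1] belongs to 𝔑^{i_1−1}_L(i_1−1, i_2−2, …, i_n−n); and (iii) A[i_1+1,…,n] belongs to 𝔑^{n−i_1}_T(n−i_1, n−i_2, …, n−i_n). -/

import Mathlib

open Polynomial Matrix

noncomputable section

/-- A square matrix is *unit lower Hessenberg* (ULH): every entry on the
superdiagonal equals `1` and every entry above the superdiagonal equals `0`. -/
def IsULH {R : Type*} [Zero R] [One R] {m : ℕ} (A : Matrix (Fin m) (Fin m) R) : Prop :=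
  (∀ i j : Fin m, (j : ℕ) = (i : ℕ) + 1 → A i j = 1) ∧
  (∀ i j : Fin m, (i : ℕ) + 1 < (j : ℕ) → A i j = 0)

/-- The total order `≺` on positions: `(i,j) ≺ (i',j')` iff `i−j < i'−j'`, or
`i−j = i'−j'` and `i < i'`. -/
def Prec {m : ℕ} (a b : Fin m × Fin m) : Prop :=
  ((a.1 : ℕ) - (a.2 : ℕ) < (b.1 : ℕ) - (b.2 : ℕ)) ∨
  ((a.1 : ℕ) - (a.2 : ℕ) = (b.1 : ℕ) - (b.2 : ℕ) ∧ (a.1 : ℕ) < (b.1 : ℕ))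

/-- `pos` is a valid family of variable positions for a matrix of `ℋ`:
each position is on or below the main diagonal, and the positions are
strictly increasing in the order `≺`. -/
def IsHPos {m : ℕ} (pos : Fin m → Fin m × Fin m) : Prop :=
  (∀ k, ((pos k).2 : ℕ) ≤ ((pos k).1 : ℕ)) ∧
  (∀ k l : Fin m, k < l → Prec (pos k) (pos l))

/-- `pos` is a valid family of variable positions for a matrix of `ℬ`:
in addition all variables lie in a common `t`-block, i.e.
`max j_k ≤ min i_k`. -/
def IsBPos {m : ℕ} (pos : Fin m → Fin m × Fin m) : Prop :=
  IsHPos pos ∧ ∀ k l : Fin m, ((pos k).2 : ℕ) ≤ ((pos l).1 : ℕ)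

/-- The ULH matrix `H_{(i₁,j₁),…,(iₙ,jₙ)}` with `2n−1` nonzero entries: ones on the
superdiagonal and the variable `xₖ` at position `pos k` (0-indexed). -/
def HMat (F : Type*) [Field F] {n : ℕ} (pos : Fin n → Fin n × Fin n) :
    Matrix (Fin n) (Fin n) (MvPolynomial (Fin n) F) :=
  fun i j => (if (j : ℕ) = (i : ℕ) + 1 then 1 else 0) +
    ∑ k : Fin n, if pos k = (i, j) then MvPolynomial.X k else 0

/-- The positions of the variables of `C_{i₁,…,iₙ}`: in 1-based terms `xₖ` lies at
`(iₖ, iₖ−k+1)`; here 0-indexed, given the row function `r`, the variable `x_{k+1}`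
lies at `(r k, r k − k)`. -/
def CPos {n : ℕ} (r : Fin n → Fin n) (k : Fin n) : Fin n × Fin n :=
  (r k, ⟨(r k : ℕ) - (k : ℕ), lt_of_le_of_lt (Nat.sub_le _ _) (r k).isLt⟩)

/-- The condition on the row indices defining the set `𝒞`: in 1-based terms
`k ≤ iₖ` and `iₖ−k+1 ≤ i₁ ≤ iₖ` for `k = 1,…,n`. -/
def IsCIdx {n : ℕ} (hn : 0 < n) (r : Fin n → Fin n) : Prop :=
  ∀ k : Fin n, (k : ℕ) ≤ (r k : ℕ) ∧
    (r k : ℕ) - (k : ℕ) ≤ (r ⟨0, hn⟩ : ℕ) ∧ (r ⟨0, hn⟩ : ℕ) ≤ (r k : ℕ)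

/-- The matrix `C_{i₁,…,iₙ}`. -/
def CMat (F : Type*) [Field F] {n : ℕ} (r : Fin n → Fin n) :
    Matrix (Fin n) (Fin n) (MvPolynomial (Fin n) F) :=
  HMat F (CPos r)

/-- The condition on the row indices defining the set `𝒢`: besides the `𝒞` conditions,
the rows of the variables are exactly `i₁,…,n` and their columns exactly `1,…,i₁`. -/
def IsGIdx {n : ℕ} (hn : 0 < n) (r : Fin n → Fin n) : Prop :=
  IsCIdx hn r ∧
  (∀ i : Fin n, (∃ k, r k = i) ↔ (r ⟨0, hn⟩ : ℕ) ≤ (i : ℕ)) ∧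
  (∀ j : Fin n, (∃ k, (r k : ℕ) - (k : ℕ) = (j : ℕ)) ↔ (j : ℕ) ≤ (r ⟨0, hn⟩ : ℕ))

/-- The condition on the row indices defining the set `ℱ` of Fiedler companion
matrices: besides the `𝒢` conditions, consecutive variables lie in the same row or
the same column, i.e. `i_{k+1} = i_k` or `i_{k+1} = i_k + 1`. -/
def IsFIdx {n : ℕ} (hn : 0 < n) (r : Fin n → Fin n) : Prop :=
  IsGIdx hn r ∧
  ∀ k l : Fin n, (l : ℕ) = (k : ℕ) + 1 → (r l = r k ∨ (r l : ℕ) = (r k : ℕ) + 1)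

/-- `B` is a *ULH superpattern* of `A`: `B` is obtained from `A` by replacing some
(possibly none) zero entries of `A` lying below the superdiagonal by nonzero
constants of `F`. -/
def IsULHSuperpatternOf {F : Type*} [Field F] {n : ℕ}
    (B A : Matrix (Fin n) (Fin n) (MvPolynomial (Fin n) F)) : Prop :=
  (∀ i j : Fin n, (i : ℕ) < (j : ℕ) → B i j = A i j) ∧
  (∀ i j : Fin n, (j : ℕ) ≤ (i : ℕ) →
    B i j = A i j ∨ (A i j = 0 ∧ ∃ c : F, c ≠ 0 ∧ B i j = MvPolynomial.C c))

/-- `A` is a *companion matrix*: `n` of its entries are the variables `x₁,…,xₙ`,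
the remaining entries are constants of `F`, and
`det(λI − A) = λⁿ − x₁λ^{n−1} − ⋯ − xₙ`. -/
def IsCompanion {F : Type*} [Field F] {n : ℕ}
    (A : Matrix (Fin n) (Fin n) (MvPolynomial (Fin n) F)) : Prop :=
  (∃ pos : Fin n → Fin n × Fin n, Function.Injective pos ∧
    (∀ k : Fin n, A (pos k).1 (pos k).2 = MvPolynomial.X k) ∧
    (∀ i j : Fin n, (∀ k, pos k ≠ (i, j)) → ∃ c : F, A i j = MvPolynomial.C c)) ∧
  A.charpoly = Polynomial.X ^ n -
    ∑ k : Fin n, Polynomial.C (MvPolynomial.X k) * Polynomial.X ^ (n - 1 - (k : ℕ))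

/-- `A` is a *PB-companion matrix* (companion with respect to a polynomial basis):
`n` of its entries are the variables `x₁,…,xₙ`, the remaining entries are constants
of `F`, and `det(λI − A) = pₙ(λ) − x₁p_{n−1}(λ) − ⋯ − xₙp₀(λ)` for some basis
`{pₙ,…,p₀}` of the space `F_n[λ]` of polynomials of degree at most `n`. -/
def IsPBCompanion {F : Type*} [Field F] {n : ℕ}
    (A : Matrix (Fin n) (Fin n) (MvPolynomial (Fin n) F)) : Prop :=
  (∃ pos : Fin n → Fin n × Fin n, Function.Injective pos ∧
    (∀ k : Fin n, A (pos k).1 (pos k).2 = MvPolynomial.X k) ∧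
    (∀ i j : Fin n, (∀ k, pos k ≠ (i, j)) → ∃ c : F, A i j = MvPolynomial.C c)) ∧
  ∃ p : Fin (n + 1) → Polynomial F,
    (∀ i, p i ∈ Polynomial.degreeLT F (n + 1)) ∧
    LinearIndependent F p ∧
    Submodule.span F (Set.range p) = Polynomial.degreeLT F (n + 1) ∧
    A.charpoly = (p ⟨n, n.lt_succ_self⟩).map (MvPolynomial.C : F →+* MvPolynomial (Fin n) F) -
      ∑ k : Fin n, Polynomial.C (MvPolynomial.X k) *
        (p ⟨n - 1 - (k : ℕ), by omega⟩).map (MvPolynomial.C : F →+* MvPolynomial (Fin n) F)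

/-- The constant part of `A`: set `x₁ = ⋯ = xₙ = 0` in every entry. -/
def constPart {F : Type*} [Field F] {n : ℕ}
    (A : Matrix (Fin n) (Fin n) (MvPolynomial (Fin n) F)) : Matrix (Fin n) (Fin n) F :=
  A.map (fun q => MvPolynomial.eval (fun _ => (0 : F)) q)

/-- The leading principal submatrix `A[1,…,m]` of order `m`. -/
def leadSub {R : Type*} {n : ℕ} (A : Matrix (Fin n) (Fin n) R) (m : ℕ) (h : m ≤ n) :
    Matrix (Fin m) (Fin m) R :=
  A.submatrix (Fin.castLE h) (Fin.castLE h)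

/-- The trailing principal submatrix `A[n−m+1,…,n]` of order `m`. -/
def trailSub {R : Type*} {n : ℕ} (A : Matrix (Fin n) (Fin n) R) (m : ℕ) (h : m ≤ n) :
    Matrix (Fin m) (Fin m) R :=
  A.submatrix (fun i => ⟨n - m + (i : ℕ), by omega⟩) (fun i => ⟨n - m + (i : ℕ), by omega⟩)

/-- A matrix whose entries are all constants of `F`. -/
def IsConstMatrix {F : Type*} [Field F] {n m : ℕ}
    (M : Matrix (Fin m) (Fin m) (MvPolynomial (Fin n) F)) : Prop :=
  ∀ i j, ∃ c : F, M i j = MvPolynomial.C c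

/-- Membership in `𝔑^m_L(n₁,…,n_s)`: a constant ULH matrix of order `m` whose
leading principal submatrix of order `ns h` is nilpotent whenever `ns h ≠ 0`. -/
def MemNL {F : Type*} [Field F] {m : ℕ} (M : Matrix (Fin m) (Fin m) F)
    {s : ℕ} (ns : Fin s → ℕ) (hns : ∀ h, ns h ≤ m) : Prop :=
  IsULH M ∧ ∀ h : Fin s, ns h ≠ 0 → IsNilpotent (leadSub M (ns h) (hns h))

/-- Membership in `𝔑^m_T(n₁,…,n_s)`: a constant ULH matrix of order `m` whose
trailing principal submatrix of order `ns h` is nilpotent whenever `ns h ≠ 0`. -/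
def MemNT {F : Type*} [Field F] {m : ℕ} (M : Matrix (Fin m) (Fin m) F)
    {s : ℕ} (ns : Fin s → ℕ) (hns : ∀ h, ns h ≤ m) : Prop :=
  IsULH M ∧ ∀ h : Fin s, ns h ≠ 0 → IsNilpotent (trailSub M (ns h) (hns h))

/-- `s_k(A)`: the sum of the entries of the `k`-subdiagonal of `A`. -/
def subdiagSum {F : Type*} [Field F] {n : ℕ}
    (A : Matrix (Fin n) (Fin n) (MvPolynomial (Fin n) F)) (k : ℕ) : MvPolynomial (Fin n) F :=
  ∑ i : Fin n, ∑ j : Fin n, if (i : ℕ) = (j : ℕ) + k then A i j else 0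

/-- The upper shift matrix `Uₘ`: ones on the superdiagonal, zeros elsewhere. -/
def Ushift (R : Type*) [Zero R] [One R] (m : ℕ) : Matrix (Fin m) (Fin m) R :=
  fun i j => if (j : ℕ) = (i : ℕ) + 1 then 1 else 0

/-- The backward identity matrix `Jₘ`: ones on the antidiagonal, zeros elsewhere. -/
def Jmat (R : Type*) [Zero R] [One R] (m : ℕ) : Matrix (Fin m) (Fin m) R :=
  fun i j => if (i : ℕ) + (j : ℕ) = m - 1 then 1 else 0

/-- The principal submatrix `M[b,…,e]` on rows and columns `b,…,e` (0-indexed). -/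
def rangeSub {R : Type*} {m : ℕ} (M : Matrix (Fin m) (Fin m) R) (b e : ℕ) (h : e < m) :
    Matrix (Fin (e + 1 - b)) (Fin (e + 1 - b)) R :=
  M.submatrix (fun i => ⟨b + (i : ℕ), by omega⟩) (fun i => ⟨b + (i : ℕ), by omega⟩)

/-- The `m × m` diagonal block of the infinite array `a` starting at index `b`. -/
def diagBlock {R : Type*} (a : ℕ → ℕ → R) (b m : ℕ) : Matrix (Fin m) (Fin m) R :=
  Matrix.of fun i j => a (b + i) (b + j)

/-- Expansion of the determinant of a leading block of a lower Hessenberg array with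
superdiagonal `-1` along its last row. -/
theorem det_diagBlock_zero_succ {R : Type*} [CommRing R] (a : ℕ → ℕ → R)
    (h1 : ∀ i, a i (i + 1) = -1) (h0 : ∀ i j, i + 1 < j → a i j = 0) (m : ℕ) :
    (diagBlock a 0 (m + 1)).det =
      ∑ j ∈ Finset.range (m + 1), a m j * (diagBlock a 0 j).det := by
  induction m using Nat.strong_induction_on with
  | _ m ih =>
    have hsum := det_updateCol_sum (diagBlock a 0 (m + 1)) 0
      (fun j => (diagBlock a 0 (j : ℕ)).det)
    have hz : (diagBlock a 0 ((0 : Fin (m + 1)) : ℕ)).det = 1 := by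
      simp only [Fin.val_zero]
      exact det_isEmpty
    simp only [hz, smul_eq_mul, one_mul] at hsum
    rw [← hsum, det_succ_column_zero, Finset.sum_eq_single (Fin.last m)]
    · have hminor : ((diagBlock a 0 (m + 1)).updateCol 0 (fun k => ∑ i : Fin (m + 1),
          (diagBlock a 0 (i : ℕ)).det * diagBlock a 0 (m + 1) k i)).submatrix
          (Fin.last m).succAbove Fin.succ = Matrix.of fun i j : Fin m => a i (j + 1) := by
        ext i j
        simp [diagBlock]
      rw [hminor, det_of_isLowerTriangular]
      · simp only [of_apply, h1, Finset.prod_const, Finset.card_univ, Fintype.card_fin,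
          updateCol_self, Fin.val_last]
        rw [mul_right_comm, ← mul_pow]
        simp only [mul_neg, mul_one, neg_neg, one_pow, one_mul]
        rw [← Fin.sum_univ_eq_sum_range (fun j => a m j * (diagBlock a 0 j).det)]
        exact Finset.sum_congr rfl fun i _ => by simp [diagBlock, mul_comm]
      · intro i j hij
        have : (i : ℕ) < j := hij
        exact h0 _ _ (by omega)
    · intro i _ hi
      have him : (i : ℕ) < m := by
        have := i.isLt
        have : (i : ℕ) ≠ m := fun h => hi (Fin.ext h)
        omega
      suffices ∑ j : Fin (m + 1), (diagBlock a 0 (j : ℕ)).det * diagBlock a 0 (m + 1) i j = 0 by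
        rw [updateCol_self, this]
        ring
      have e : ∀ j : Fin (m + 1), (diagBlock a 0 (j : ℕ)).det * diagBlock a 0 (m + 1) i j =
          (fun j : ℕ => a i j * (diagBlock a 0 j).det) j := fun j => by
        simp [diagBlock, mul_comm]
      rw [Finset.sum_congr rfl fun j _ => e j,
        Fin.sum_univ_eq_sum_range (fun j => a i j * (diagBlock a 0 j).det),
        ← Finset.sum_subset (Finset.range_subset_range.2 (by omega : (i : ℕ) + 2 ≤ m + 1)),
        Finset.sum_range_succ, ← ih i him, h1]
      · ring
      · intro j _ hj
        rw [Finset.mem_range] at hj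
        rw [h0 _ _ (by omega), zero_mul]
    · simp

theorem det_diagBlock_succ {R : Type*} [CommRing R] (a : ℕ → ℕ → R)
    (h1 : ∀ i, a i (i + 1) = -1) (h0 : ∀ i j, i + 1 < j → a i j = 0) (b m : ℕ) :
    (diagBlock a b (m + 1)).det =
      ∑ j ∈ Finset.range (m + 1), a (b + m) (b + j) * (diagBlock a b j).det := by
  have h := det_diagBlock_zero_succ (fun i j => a (b + i) (b + j)) (fun i => h1 (b + i))
    (fun i j hij => h0 _ _ (by omega)) m
  simpa [diagBlock] using h

/-- Expansion of the determinant of a lower Hessenberg array with superdiagonal `-1` by the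
unique cycle passing through a given index `p`. -/
theorem det_diagBlock_expand {R : Type*} [CommRing R] (a : ℕ → ℕ → R)
    (h1 : ∀ i, a i (i + 1) = -1) (h0 : ∀ i j, i + 1 < j → a i j = 0) (p n : ℕ) (hp : p < n) :
    (diagBlock a 0 n).det = ∑ i ∈ Finset.Ico p n,
      (∑ j ∈ Finset.range (p + 1), a i j * (diagBlock a 0 j).det) *
        (diagBlock a (i + 1) (n - 1 - i)).det := by
  induction n using Nat.strong_induction_on with
  | _ n ih =>
    obtain ⟨m, rfl⟩ : ∃ m, n = m + 1 := ⟨n - 1, by omega⟩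
    rw [det_diagBlock_zero_succ a h1 h0,
      ← Finset.sum_range_add_sum_Ico _ (by omega : p + 1 ≤ m + 1),
      Finset.sum_Ico_succ_top (by omega : p ≤ m), add_comm]
    congr 1
    · rw [Finset.sum_congr rfl fun j hj => by
        rw [ih j (Finset.mem_Ico.1 hj).2 (by have := (Finset.mem_Ico.1 hj).1; omega)]]
      simp_rw [Finset.mul_sum]
      rw [Finset.sum_comm' (t' := Finset.Ico p m) (s' := fun i => Finset.Ico (i + 1) (m + 1))
        (by intro x y; simp only [Finset.mem_Ico]; omega)]
      refine Finset.sum_congr rfl fun i hi => ?_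
      have hi' := (Finset.mem_Ico.1 hi)
      obtain ⟨t, ht⟩ : ∃ t, m + 1 - 1 - i = t + 1 := ⟨m - i - 1, by omega⟩
      rw [ht, det_diagBlock_succ a h1 h0, Finset.mul_sum, Finset.sum_Ico_eq_sum_range]
      have e : m + 1 - (i + 1) = t + 1 := by omega
      rw [e]
      refine Finset.sum_congr rfl fun j _ => ?_
      have e2 : i + 1 + j - 1 - i = j := by omega
      have e3 : i + 1 + t = m := by omega
      rw [e2, e3]
      ring
    · have e : m + 1 - 1 - m = 0 := by omega
      rw [e, det_isEmpty, mul_one]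

/-- The array of entries of the characteristic matrices of the blocks of `a`. -/
def charArray {R : Type*} [CommRing R] (a : ℕ → ℕ → R) (i j : ℕ) : R[X] :=
  (if i = j then Polynomial.X else 0) - Polynomial.C (a i j)

theorem charmatrix_diagBlock {R : Type*} [CommRing R] (a : ℕ → ℕ → R) (b m : ℕ) :
    charmatrix (diagBlock a b m) = diagBlock (charArray a) b m := by
  ext1 i j
  simp [charmatrix_apply, diagBlock, charArray, diagonal_apply, Fin.ext_iff]

theorem charpoly_diagBlock_expand {R : Type*} [CommRing R] (a : ℕ → ℕ → R)
    (h1 : ∀ i, a i (i + 1) = 1) (h0 : ∀ i j, i + 1 < j → a i j = 0) (p n : ℕ) (hp : p < n) :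
    (diagBlock a 0 n).charpoly = ∑ i ∈ Finset.Ico p n,
      (∑ j ∈ Finset.range (p + 1), charArray a i j * (diagBlock a 0 j).charpoly) *
        (diagBlock a (i + 1) (n - 1 - i)).charpoly := by
  simp only [Matrix.charpoly, charmatrix_diagBlock]
  refine det_diagBlock_expand _ (fun i => ?_) (fun i j hij => ?_) p n hp
  · simp [charArray, h1]
  · rw [charArray, if_neg (by omega), h0 i j hij]
    simp

/-- Extension of a square matrix to an infinite array by the shift pattern. -/
def hessExtend {R : Type*} [Zero R] [One R] {n : ℕ} (A : Matrix (Fin n) (Fin n) R) (i j : ℕ) : R :=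
  if h : i < n ∧ j < n then A ⟨i, h.1⟩ ⟨j, h.2⟩ else if j = i + 1 then 1 else 0

theorem diagBlock_hessExtend {R : Type*} [Zero R] [One R] {n : ℕ}
    (A : Matrix (Fin n) (Fin n) R) : diagBlock (hessExtend A) 0 n = A := by
  ext i j
  simp [diagBlock, hessExtend]

theorem leadSub_eq_diagBlock {R : Type*} [Zero R] [One R] {n : ℕ}
    (A : Matrix (Fin n) (Fin n) R) (m : ℕ) (h : m ≤ n) :
    leadSub A m h = diagBlock (hessExtend A) 0 m := by
  ext i j
  have hi : (i : ℕ) < n := by omega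
  have hj : (j : ℕ) < n := by omega
  simp [leadSub, diagBlock, hessExtend, hi, hj, Fin.castLE]

theorem trailSub_eq_diagBlock {R : Type*} [Zero R] [One R] {n : ℕ}
    (A : Matrix (Fin n) (Fin n) R) (m : ℕ) (h : m ≤ n) :
    trailSub A m h = diagBlock (hessExtend A) (n - m) m := by
  ext i j
  have hi : n - m + (i : ℕ) < n := by omega
  have hj : n - m + (j : ℕ) < n := by omega
  simp [trailSub, diagBlock, hessExtend, hi, hj]

theorem leadSub_leadSub {R : Type*} {n : ℕ} (A : Matrix (Fin n) (Fin n) R) (m l : ℕ)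
    (h : m ≤ n) (h' : l ≤ m) : leadSub (leadSub A m h) l h' = leadSub A l (h'.trans h) := rfl

theorem trailSub_trailSub {R : Type*} {n : ℕ} (A : Matrix (Fin n) (Fin n) R) (m l : ℕ)
    (h : m ≤ n) (h' : l ≤ m) : trailSub (trailSub A m h) l h' = trailSub A l (h'.trans h) := by
  ext i j
  simp only [trailSub, submatrix_apply]
  congr 2 <;> omega

theorem hessExtend_superdiag {R : Type*} [Zero R] [One R] {n : ℕ}
    {A : Matrix (Fin n) (Fin n) R} (hA : IsULH A) (i : ℕ) : hessExtend A i (i + 1) = 1 := by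
  unfold hessExtend
  split_ifs with h
  · exact hA.1 _ _ rfl
  · rfl
  · omega

theorem hessExtend_above {R : Type*} [Zero R] [One R] {n : ℕ}
    {A : Matrix (Fin n) (Fin n) R} (hA : IsULH A) (i j : ℕ) (hij : i + 1 < j) :
    hessExtend A i j = 0 := by
  unfold hessExtend
  split_ifs with h h'
  · exact hA.2 _ _ hij
  · omega
  · rfl

theorem IsULH.leadSub {R : Type*} [Zero R] [One R] {n : ℕ}
    {A : Matrix (Fin n) (Fin n) R} (hA : IsULH A) (m : ℕ) (h : m ≤ n) :
    IsULH (leadSub A m h) :=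
  ⟨fun _ _ hij => hA.1 _ _ hij, fun _ _ hij => hA.2 _ _ hij⟩

theorem IsULH.trailSub {R : Type*} [Zero R] [One R] {n : ℕ}
    {A : Matrix (Fin n) (Fin n) R} (hA : IsULH A) (m : ℕ) (h : m ≤ n) :
    IsULH (trailSub A m h) :=
  ⟨fun i j hij => hA.1 _ _ (show n - m + (j : ℕ) = n - m + i + 1 by omega),
    fun i j hij => hA.2 _ _ (show n - m + (i : ℕ) + 1 < n - m + j by omega)⟩

theorem isNilpotent_matrix_iff_charpoly {F : Type*} [Field F] {m : ℕ}
    (M : Matrix (Fin m) (Fin m) F) : IsNilpotent M ↔ M.charpoly = Polynomial.X ^ m := by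
  constructor
  · intro h
    have := (isNilpotent_charpoly_sub_pow_of_isNilpotent h).eq_zero
    simpa [sub_eq_zero] using this
  · intro h
    exact ⟨m, by simpa [h] using aeval_self_charpoly M⟩

theorem eq_X_pow_of_dvd_X_pow {F : Type*} [Field F] {q : F[X]} (hq : q.Monic) {N : ℕ}
    (h : q ∣ Polynomial.X ^ N) : q = Polynomial.X ^ q.natDegree := by
  obtain ⟨i, _, hi⟩ := (dvd_prime_pow Polynomial.prime_X N).1 h
  have e := eq_of_monic_of_associated hq (monic_X_pow i) hi
  rw [e, natDegree_X_pow]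

/-- A product of characteristic polynomials is a power of the variable of the right degree
exactly when both matrices are nilpotent. -/
theorem charpoly_mul_charpoly_eq_X_pow_iff {F : Type*} [Field F] {l m : ℕ}
    (M : Matrix (Fin l) (Fin l) F) (N : Matrix (Fin m) (Fin m) F) :
    M.charpoly * N.charpoly = Polynomial.X ^ (l + m) ↔ IsNilpotent M ∧ IsNilpotent N := by
  rw [isNilpotent_matrix_iff_charpoly, isNilpotent_matrix_iff_charpoly]
  constructor
  · intro h
    have hM := eq_X_pow_of_dvd_X_pow M.charpoly_monic (Dvd.intro _ h)
    have hN := eq_X_pow_of_dvd_X_pow N.charpoly_monic (Dvd.intro_left _ h)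
    simpa using And.intro hM hN
  · rintro ⟨h, h'⟩
    rw [h, h', pow_add]

theorem CPos_eq_iff {n : ℕ} (r : Fin n → Fin n) (k i j : Fin n) :
    CPos r k = (i, j) ↔ (r k : ℕ) = i ∧ (r k : ℕ) - k = j := by
  simp [CPos, Prod.ext_iff, Fin.ext_iff]

theorem CPos_injective {n : ℕ} {r : Fin n → Fin n} (hr : ∀ k : Fin n, (k : ℕ) ≤ r k) :
    Function.Injective (CPos r) := by
  intro k l h
  obtain ⟨h1, h2⟩ := (CPos_eq_iff r k _ _).1 h
  simp only at h1 h2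
  have := hr k
  have := hr l
  ext
  omega

theorem CMat_apply_of_lt {F : Type*} [Field F] {n : ℕ} (r : Fin n → Fin n) (i j : Fin n)
    (hij : (i : ℕ) < j) : CMat F r i j = if (j : ℕ) = i + 1 then 1 else 0 := by
  rw [CMat, HMat, Finset.sum_eq_zero, add_zero]
  intro k _
  rw [if_neg]
  rw [CPos_eq_iff]
  omega

section Superpattern

variable {F : Type*} [Field F] {n : ℕ} {r : Fin n → Fin n}
  {A : Matrix (Fin n) (Fin n) (MvPolynomial (Fin n) F)}

theorem IsULHSuperpatternOf.isULH (hA : IsULHSuperpatternOf A (CMat F r)) : IsULH A := by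
  constructor
  · intro i j hij
    rw [hA.1 i j (by omega), CMat_apply_of_lt r i j (by omega), if_pos hij]
  · intro i j hij
    rw [hA.1 i j (by omega), CMat_apply_of_lt r i j (by omega), if_neg (by omega)]

theorem IsULH.constPart (hA : IsULH A) : IsULH (constPart A) :=
  ⟨fun i j hij => by simp [_root_.constPart, hA.1 i j hij],
    fun i j hij => by simp [_root_.constPart, hA.2 i j hij]⟩

theorem IsULHSuperpatternOf.apply_eq (hA : IsULHSuperpatternOf A (CMat F r)) (i j : Fin n) :
    A i j = MvPolynomial.C (constPart A i j) +
      ∑ k : Fin n, if CPos r k = (i, j) then MvPolynomial.X k else 0 := by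
  have key : A i j = CMat F r i j → A i j = MvPolynomial.C (constPart A i j) +
      ∑ k : Fin n, if CPos r k = (i, j) then MvPolynomial.X k else 0 := by
    intro h
    rw [constPart, map_apply, h, CMat, HMat]
    congr 1
    simp only [map_add, map_sum, apply_ite (MvPolynomial.eval fun _ => (0 : F)),
      apply_ite (MvPolynomial.C : F →+* MvPolynomial (Fin n) F), map_one, map_zero,
      MvPolynomial.eval_X, ite_self, Finset.sum_const_zero, add_zero]
  rcases lt_or_ge (i : ℕ) j with hij | hij
  · exact key (hA.1 i j hij)
  · rcases hA.2 i j hij with h | ⟨h0, c, -, hc⟩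
    · exact key h
    · rw [CMat, HMat, if_neg (by omega), zero_add] at h0
      rw [h0, add_zero, constPart, map_apply, hc, MvPolynomial.eval_C]

theorem IsULHSuperpatternOf.apply_CPos (hA : IsULHSuperpatternOf A (CMat F r))
    (hr : ∀ k : Fin n, (k : ℕ) ≤ r k) (k : Fin n) : A (CPos r k).1 (CPos r k).2 = MvPolynomial.X k := by
  have hle : ((CPos r k).2 : ℕ) ≤ (CPos r k).1 := Nat.sub_le _ _
  have hC : CMat F r (CPos r k).1 (CPos r k).2 = MvPolynomial.X k := by
    rw [CMat, HMat, if_neg (by omega), zero_add]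
    simp [(CPos_injective hr).eq_iff]
  rcases hA.2 _ _ hle with h | ⟨h0, -⟩
  · rw [h, hC]
  · rw [hC] at h0
    exact absurd h0 (MvPolynomial.X_ne_zero k)

theorem IsULHSuperpatternOf.apply_const (hA : IsULHSuperpatternOf A (CMat F r)) (i j : Fin n)
    (h : ∀ k, CPos r k ≠ (i, j)) : A i j = MvPolynomial.C (constPart A i j) := by
  rw [hA.apply_eq i j, Finset.sum_eq_zero fun k _ => if_neg (h k), add_zero]

theorem IsULHSuperpatternOf.hessExtend_eq (hA : IsULHSuperpatternOf A (CMat F r)) (i j : ℕ) :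
    hessExtend A i j = MvPolynomial.C (hessExtend (constPart A) i j) +
      ∑ k : Fin n, if (r k : ℕ) = i ∧ (r k : ℕ) - k = j then MvPolynomial.X k else 0 := by
  unfold hessExtend
  split_ifs with h h'
  · rw [hA.apply_eq]
    simp only [CPos_eq_iff]
  all_goals
    rw [Finset.sum_eq_zero fun k _ => if_neg (by have := (r k).isLt; omega), add_zero]
    simp

theorem charpoly_map_C (M : ℕ → ℕ → F) (N : ℕ → ℕ → MvPolynomial (Fin n) F) (b m : ℕ)
    (h : ∀ i j, i < m → j < m → N (b + i) (b + j) = MvPolynomial.C (M (b + i) (b + j))) :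
    (diagBlock N b m).charpoly = (diagBlock M b m).charpoly.map MvPolynomial.C := by
  rw [← charpoly_map]
  congr 1
  ext1 i j
  exact h i j i.isLt j.isLt

/-- The characteristic polynomial of a superpattern of `C_{i₁,…,iₙ}` is affine in the variables,
with coefficients given by the leading and trailing blocks complementary to each variable. -/
theorem IsULHSuperpatternOf.charpoly_eq (hn : 0 < n) (hr : IsCIdx hn r)
    (hA : IsULHSuperpatternOf A (CMat F r)) :
    A.charpoly = (constPart A).charpoly.map MvPolynomial.C -
      ∑ k : Fin n, Polynomial.C (MvPolynomial.X k) *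
        ((leadSub (constPart A) (r k - k) (by omega)).charpoly *
          (trailSub (constPart A) (n - 1 - r k) (by omega)).charpoly).map MvPolynomial.C := by
  obtain ⟨p, hp⟩ : ∃ p, p = (r ⟨0, hn⟩ : ℕ) := ⟨_, rfl⟩
  have hpn : p < n := hp ▸ (r ⟨0, hn⟩).isLt
  have hrow : ∀ k, p ≤ r k := fun k => hp ▸ (hr k).2.2
  have hcol : ∀ k : Fin n, (r k : ℕ) - k ≤ p := fun k => hp ▸ (hr k).2.1
  have hU := hA.isULH
  have hconst : ∀ i j, i < p ∨ p < j →
      hessExtend A i j = MvPolynomial.C (hessExtend (constPart A) i j) := by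
    intro i j hij
    rw [hA.hessExtend_eq, Finset.sum_eq_zero, add_zero]
    intro k _
    rw [if_neg]
    have := hrow k
    have := hcol k
    omega
  have hlead : ∀ j, j ≤ p → (diagBlock (hessExtend A) 0 j).charpoly =
      (diagBlock (hessExtend (constPart A)) 0 j).charpoly.map MvPolynomial.C := fun j hj =>
    charpoly_map_C _ _ _ _ fun i l hi _ => hconst _ _ (by omega)
  have htrail : ∀ i m, p ≤ i → (diagBlock (hessExtend A) (i + 1) m).charpoly =
      (diagBlock (hessExtend (constPart A)) (i + 1) m).charpoly.map MvPolynomial.C :=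
    fun i m hi => charpoly_map_C _ _ _ _ fun _ _ _ _ => hconst _ _ (by omega)
  have hchar : ∀ i j, charArray (hessExtend A) i j =
      (charArray (hessExtend (constPart A)) i j).map MvPolynomial.C -
      ∑ k : Fin n, if (r k : ℕ) = i ∧ (r k : ℕ) - k = j
        then Polynomial.C (MvPolynomial.X k) else 0 := by
    intro i j
    rw [charArray, hA.hessExtend_eq, charArray]
    simp only [map_add, map_sum, Polynomial.map_sub, Polynomial.map_C,
      apply_ite (Polynomial.map (MvPolynomial.C : F →+* MvPolynomial (Fin n) F)),
      Polynomial.map_X, Polynomial.map_zero,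
      apply_ite (Polynomial.C : MvPolynomial (Fin n) F →+* _), map_zero]
    ring
  have hE := charpoly_diagBlock_expand _ (hessExtend_superdiag hU) (hessExtend_above hU) p n hpn
  have hE' := charpoly_diagBlock_expand _ (hessExtend_superdiag hU.constPart)
    (hessExtend_above hU.constPart) p n hpn
  rw [diagBlock_hessExtend] at hE hE'
  have hterm : ∀ i j, i ∈ Finset.Ico p n → j ∈ Finset.range (p + 1) →
      charArray (hessExtend A) i j * (diagBlock (hessExtend A) 0 j).charpoly *
        (diagBlock (hessExtend A) (i + 1) (n - 1 - i)).charpoly =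
      (charArray (hessExtend (constPart A)) i j *
        (diagBlock (hessExtend (constPart A)) 0 j).charpoly *
        (diagBlock (hessExtend (constPart A)) (i + 1) (n - 1 - i)).charpoly).map
          MvPolynomial.C -
      ∑ k : Fin n, if (r k : ℕ) = i ∧ (r k : ℕ) - k = j then
        Polynomial.C (MvPolynomial.X k) *
          ((diagBlock (hessExtend (constPart A)) 0 j).charpoly *
          (diagBlock (hessExtend (constPart A)) (i + 1) (n - 1 - i)).charpoly).map
            MvPolynomial.C else 0 := by
    intro i j hi hj
    rw [hlead j (by simpa [Nat.lt_succ_iff] using hj), htrail i _ (Finset.mem_Ico.1 hi).1, hchar]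
    simp only [Polynomial.map_mul, sub_mul, Finset.sum_mul, ite_mul, zero_mul, mul_assoc]
  rw [hE, hE', Polynomial.map_sum]
  simp_rw [Finset.sum_mul, Polynomial.map_sum]
  rw [Finset.sum_congr rfl fun i hi => Finset.sum_congr rfl fun j hj => hterm i j hi hj]
  simp_rw [Finset.sum_sub_distrib]
  congr 1
  rw [Finset.sum_congr rfl fun i _ => Finset.sum_comm, Finset.sum_comm]
  refine Finset.sum_congr rfl fun k _ => ?_
  rw [Finset.sum_eq_single_of_mem (r k : ℕ) (Finset.mem_Ico.2 ⟨hrow k, (r k).isLt⟩),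
    Finset.sum_eq_single_of_mem ((r k : ℕ) - k)
      (Finset.mem_range.2 (Nat.lt_succ_of_le (hcol k))), if_pos ⟨rfl, rfl⟩,
    leadSub_eq_diagBlock, trailSub_eq_diagBlock]
  · have e : n - (n - 1 - (r k : ℕ)) = r k + 1 := by
      have := (r k).isLt
      omega
    rw [e]
  · intro j _ hj
    exact if_neg fun h => hj h.2.symm
  · intro i _ hi
    exact Finset.sum_eq_zero fun j _ => if_neg fun h => hi h.1.symm


theorem isNilpotent_of_ne_zero_imp {m : ℕ} {M : Matrix (Fin m) (Fin m) F}
    (h : m ≠ 0 → IsNilpotent M) : IsNilpotent M := by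
  rcases Nat.eq_zero_or_pos m with rfl | hm
  · exact ⟨1, Subsingleton.elim _ _⟩
  · exact h hm.ne'

end Superpattern

/-- A ULH superpattern `A` of `C_{i₁,…,iₙ} ∈ 𝒞` is a companion
matrix iff (i) the constant part of `A` is nilpotent, (ii) `A[1,…,i₁−1]` belongs to
`𝔑^{i₁−1}_L(i₁−1, i₂−2, …, iₙ−n)`, and (iii) `A[i₁+1,…,n]` belongs to
`𝔑^{n−i₁}_T(n−i₁, n−i₂, …, n−iₙ)`. -/
theorem superpattern_isCompanion_iff_nested {F : Type*} [Field F] {n : ℕ} (hn : 0 < n)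
    (r : Fin n → Fin n) (hr : IsCIdx hn r)
    (A : Matrix (Fin n) (Fin n) (MvPolynomial (Fin n) F))
    (hA : IsULHSuperpatternOf A (CMat F r)) :
    IsCompanion A ↔
      (IsNilpotent (constPart A) ∧
      (IsConstMatrix (leadSub A (r ⟨0, hn⟩ : ℕ) (r ⟨0, hn⟩).isLt.le) ∧
        MemNL (leadSub (constPart A) (r ⟨0, hn⟩ : ℕ) (r ⟨0, hn⟩).isLt.le)
          (fun k : Fin n => (r k : ℕ) - (k : ℕ)) (fun k => (hr k).2.1)) ∧
      (IsConstMatrix (trailSub A (n - 1 - (r ⟨0, hn⟩ : ℕ)) (by omega)) ∧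
        MemNT (trailSub (constPart A) (n - 1 - (r ⟨0, hn⟩ : ℕ)) (by omega))
          (fun k : Fin n => n - 1 - (r k : ℕ)) (fun k => by
            have h2 := (hr k).2.2
            show n - 1 - (r k : ℕ) ≤ n - 1 - (r ⟨0, hn⟩ : ℕ)
            omega))) := by
  have hle : ∀ k : Fin n, (k : ℕ) ≤ r k := fun k => (hr k).1
  have hlen : ∀ k : Fin n, (r k : ℕ) - k + (n - 1 - r k) = n - 1 - k := fun k => by
    have := hle k
    omega
  have hformula := hA.charpoly_eq hn hr
  have hconv : IsCompanion A ↔ IsNilpotent (constPart A) ∧ ∀ k : Fin n,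
      IsNilpotent (leadSub (constPart A) (r k - k) (by omega)) ∧
      IsNilpotent (trailSub (constPart A) (n - 1 - r k) (by omega)) := by
    simp_rw [← charpoly_mul_charpoly_eq_X_pow_iff, isNilpotent_matrix_iff_charpoly, hlen]
    constructor
    · rintro ⟨-, h⟩
      rw [hformula] at h
      have hev : ∀ x : Fin n → F, (constPart A).charpoly -
          ∑ k : Fin n, Polynomial.C (x k) *
            ((leadSub (constPart A) (r k - k) (by omega)).charpoly *
              (trailSub (constPart A) (n - 1 - r k) (by omega)).charpoly) =
          Polynomial.X ^ n - ∑ k : Fin n, Polynomial.C (x k) * Polynomial.X ^ (n - 1 - (k : ℕ)) := by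
        intro x
        have hx := congrArg (Polynomial.map (MvPolynomial.eval x)) h
        have hcomp : (MvPolynomial.eval x).comp MvPolynomial.C = RingHom.id F := by
          ext
          simp
        simpa [Polynomial.map_sum, Polynomial.map_map, hcomp] using hx
      have h0 : (constPart A).charpoly = Polynomial.X ^ n := by simpa using hev 0
      refine ⟨h0, fun k => ?_⟩
      simpa [h0, Pi.single_apply, apply_ite (Polynomial.C : F →+* F[X]), ite_mul]
        using hev (Pi.single k 1)
    · rintro ⟨h0, h⟩
      refine ⟨⟨CPos r, CPos_injective hle, hA.apply_CPos hle,
        fun i j hij => ⟨_, hA.apply_const i j hij⟩⟩, ?_⟩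
      rw [hformula, h0]
      simp [h]
  rw [hconv]
  have hU := hA.isULH.constPart
  have hlead : IsConstMatrix (leadSub A (r ⟨0, hn⟩ : ℕ) (r ⟨0, hn⟩).isLt.le) := fun i j =>
    ⟨_, hA.apply_const _ _ fun k h => by
      have h1 := ((CPos_eq_iff r k _ _).1 h).1
      have h2 := (hr k).2.2
      simp only [Fin.val_castLE] at h1
      omega⟩
  have htrail : IsConstMatrix (trailSub A (n - 1 - (r ⟨0, hn⟩ : ℕ)) (by omega)) := fun i j =>
    ⟨_, hA.apply_const _ _ fun k h => by
      have h1 := ((CPos_eq_iff r k _ _).1 h).2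
      have h2 := (hr k).2.1
      simp only at h1
      omega⟩
  simp only [MemNL, MemNT, hlead, htrail, hU.leadSub, hU.trailSub, true_and, leadSub_leadSub,
    trailSub_trailSub, forall_and]
  exact and_congr_right fun _ => and_congr
    (forall_congr' fun k => ⟨fun h _ => h, isNilpotent_of_ne_zero_imp⟩)
    (forall_congr' fun k => ⟨fun h _ => h, isNilpotent_of_ne_zero_imp⟩)
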